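/- arXiv:2007.12832 — 2 statements merged into one kernel-verified Lean document; each statement's English description precedes it below -/
import Mathlib

section
/- Existence of a modified plane wave (Jost solution): let ξ ∈ (0, π) and set λ = arccos(ρ_∞·cos ξ) ∈ (0, π), so cos λ = ρ_∞·cos ξ. Then there exist r ∈ ℕ, ζ : ℤ → ℝ and φ : ℤ → ℂ² such that: (a) ζ(x) = ξ for |x| < r, and for |x| ≥ r one has ζ(x) ∈ (0, π) and ρ(x)·cos ζ(x) = ρ_∞·cos ξ; (b) ζ(x) → ξ as |x| → ∞; (c) φ(x+1) = T_λ(x)·φ(x) for all x ∈ ℤ, where T_λ(x) = ρ(x)⁻¹·[[e^{iλ}, α(x)], [conj(α(x)), e^{−iλ}]]; (d) sup_{x∈ℤ} ‖φ(x)‖ < ∞; (e) ‖φ(x) − e^{iZ(x)}·ν₊‖ → 0 as x → +∞, where Z(0) = 0, Z(x) = ∑_{y=0}^{x−1} ζ(y) for x ≥ 1, and ν₊ = (α₊, ρ_∞·e^{iξ} − e^{iλ}) ∈ ℂ². In particular φ(x) ≠ 0 for every x ∈ ℤ. -/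
open Complex Filter

/-- The pair `(u, v)` solves the transfer-matrix recursion at frequency `lam`. -/
def IsTransferSolution (α : ℤ → ℂ) (ρ : ℤ → ℝ) (lam : ℝ) (u v : ℤ → ℂ) : Prop :=
  ∀ x : ℤ,
    u (x + 1) = (ρ x : ℂ)⁻¹ * (Complex.exp (Complex.I * (lam : ℂ)) * u x + α x * v x) ∧
    v (x + 1) = (ρ x : ℂ)⁻¹ * ((starRingEnd ℂ) (α x) * u x
      + Complex.exp (-(Complex.I * (lam : ℂ))) * v x)

/-- The linear form `(conj a, i (t - σ))`; for `t ^ 2 = σ ^ 2 - ‖a‖ ^ 2` it is a left eigenvector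
of the transfer matrix. -/
def eigenform (a : ℂ) (t σ : ℝ) (u v : ℂ) : ℂ :=
  (starRingEnd ℂ) a * u + I * ((t : ℂ) - σ) * v

theorem exists_int_recursion {G : Type*} [Group G] (T : ℤ → G) :
    ∃ Φ : ℤ → G, ∀ x, Φ (x + 1) = T x * Φ x := by
  refine ⟨fun x => Int.rec (fun n => Nat.rec 1 (fun k g => T k * g) n)
    (fun n => Nat.rec (T (-1))⁻¹ (fun k g => (T (-(k + 2)))⁻¹ * g) n) x, fun x => ?_⟩
  obtain n | n := x
  · rfl
  · obtain _ | n := n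
    · change 1 = T (-1) * (T (-1))⁻¹
      simp
    · have h1 : Int.negSucc (n + 1) + 1 = Int.negSucc n := by omega
      have h2 : Int.negSucc (n + 1) = -((n : ℤ) + 2) := by omega
      rw [h1]
      change _ = T (Int.negSucc (n + 1)) * ((T (-(n + 2)))⁻¹ * _)
      rw [h2]
      simp

theorem exists_transferSolution_pair (α : ℤ → ℂ) (ρ : ℤ → ℝ) (lam : ℝ)
    (hρ0 : ∀ x, 0 < ρ x) (hρ2 : ∀ x, ρ x ^ 2 = 1 - ‖α x‖ ^ 2) :
    ∃ u₁ v₁ u₂ v₂ : ℤ → ℂ, IsTransferSolution α ρ lam u₁ v₁ ∧ IsTransferSolution α ρ lam u₂ v₂ ∧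
      ∀ x, u₁ x * v₂ x - u₂ x * v₁ x = 1 := by
  let T : ℤ → Matrix.SpecialLinearGroup (Fin 2) ℂ := fun x =>
    ⟨!![(ρ x : ℂ)⁻¹ * Complex.exp (Complex.I * (lam : ℂ)), (ρ x : ℂ)⁻¹ * α x;
        (ρ x : ℂ)⁻¹ * (starRingEnd ℂ) (α x),
        (ρ x : ℂ)⁻¹ * Complex.exp (-(Complex.I * (lam : ℂ)))], by
      have h1 : α x * (starRingEnd ℂ) (α x) = 1 - (ρ x : ℂ) ^ 2 := by
        rw [Complex.mul_conj, Complex.normSq_eq_norm_sq]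
        have := hρ2 x
        rw [show ‖α x‖ ^ 2 = 1 - ρ x ^ 2 by linarith]
        push_cast; ring
      have h2 : Complex.exp (Complex.I * (lam : ℂ)) * Complex.exp (-(Complex.I * (lam : ℂ))) = 1 := by
        rw [← Complex.exp_add]; simp
      have h3 : (ρ x : ℂ) ≠ 0 := by exact_mod_cast (hρ0 x).ne'
      rw [Matrix.det_fin_two_of]
      field_simp
      linear_combination h2 - h1⟩
  obtain ⟨Φ, hΦ⟩ := exists_int_recursion T
  have hcoe : ∀ x, (Φ (x + 1) : Matrix (Fin 2) (Fin 2) ℂ) = (T x : Matrix (Fin 2) (Fin 2) ℂ) * Φ x :=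
    fun x => by rw [hΦ]; simp
  refine ⟨fun x => (Φ x).1 0 0, fun x => (Φ x).1 1 0, fun x => (Φ x).1 0 1, fun x => (Φ x).1 1 1,
    fun x => ⟨?_, ?_⟩, fun x => ⟨?_, ?_⟩, fun x => ?_⟩
  · simp only [hcoe, Matrix.mul_apply, Fin.sum_univ_two]; simp [T]; ring
  · simp only [hcoe, Matrix.mul_apply, Fin.sum_univ_two]; simp [T]; ring
  · simp only [hcoe, Matrix.mul_apply, Fin.sum_univ_two]; simp [T]; ring
  · simp only [hcoe, Matrix.mul_apply, Fin.sum_univ_two]; simp [T]; ring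
  · have := (Φ x).2
    rw [Matrix.det_fin_two] at this
    exact this

theorem exp_I_mul_ofReal (x : ℝ) :
    Complex.exp (Complex.I * (x : ℂ)) = (Real.cos x : ℂ) + Real.sin x * I := by
  rw [mul_comm, Complex.exp_mul_I]; simp

theorem exp_neg_I_mul_ofReal (x : ℝ) :
    Complex.exp (-(Complex.I * (x : ℂ))) = (Real.cos x : ℂ) - Real.sin x * I := by
  have := exp_I_mul_ofReal (-x)
  simp only [Complex.ofReal_neg, mul_neg, Real.cos_neg, Real.sin_neg] at this
  rw [this]; ring

theorem IsTransferSolution.eigenform_step {α : ℤ → ℂ} {ρ : ℤ → ℝ} {lam : ℝ} {u v : ℤ → ℂ}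
    (h : IsTransferSolution α ρ lam u v) {x : ℤ} {t θ : ℝ} (hρ0 : 0 < ρ x)
    (ht : t ^ 2 = Real.sin lam ^ 2 - ‖α x‖ ^ 2)
    (hcos : ρ x * Real.cos θ = Real.cos lam) (hsin : ρ x * Real.sin θ = t) :
    eigenform (α x) t (Real.sin lam) (u (x + 1)) (v (x + 1)) =
      Complex.exp (Complex.I * (θ : ℂ)) * eigenform (α x) t (Real.sin lam) (u x) (v x) := by
  have h3 : (ρ x : ℂ) ≠ 0 := by exact_mod_cast hρ0.ne'
  have h1 : α x * (starRingEnd ℂ) (α x) = (Real.sin lam : ℂ) ^ 2 - (t : ℂ) ^ 2 := by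
    rw [Complex.mul_conj, Complex.normSq_eq_norm_sq]
    rw [show ‖α x‖ ^ 2 = Real.sin lam ^ 2 - t ^ 2 by linarith]
    push_cast; ring
  have h4 : (ρ x : ℂ) * Complex.exp (Complex.I * (θ : ℂ)) = (Real.cos lam : ℂ) + t * I := by
    rw [exp_I_mul_ofReal, ← hcos, ← hsin]; push_cast; ring
  rw [(h x).1, (h x).2, exp_I_mul_ofReal lam, exp_neg_I_mul_ofReal lam]
  refine mul_left_cancel₀ h3 ?_
  rw [← mul_assoc (ρ x : ℂ) (Complex.exp _), h4]
  unfold eigenform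
  field_simp
  linear_combination (v x) * h1 + v x * ((t - Real.sin lam) * (-t - Real.sin lam)) * I_sq

theorem norm_eigenform_sub_le (a b u v : ℂ) (s t σ : ℝ) :
    ‖eigenform a s σ u v - eigenform b t σ u v‖ ≤ (‖a - b‖ + |s - t|) * (‖u‖ + ‖v‖) := by
  have : eigenform a s σ u v - eigenform b t σ u v
      = (starRingEnd ℂ) (a - b) * u + I * ((s - t : ℝ) : ℂ) * v := by
    unfold eigenform; rw [map_sub]; push_cast; ring
  rw [this]
  refine (norm_add_le _ _).trans ?_
  simp only [norm_mul, RCLike.norm_conj, norm_I, Complex.norm_real, Real.norm_eq_abs, one_mul]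
  nlinarith [norm_nonneg (a - b), norm_nonneg u, norm_nonneg v, abs_nonneg (s - t),
    mul_nonneg (norm_nonneg (a - b)) (norm_nonneg v), mul_nonneg (abs_nonneg (s - t)) (norm_nonneg u)]

theorem eigenform_sub_neg (a u v : ℂ) (s σ : ℝ) :
    eigenform a s σ u v - eigenform a (-s) σ u v = 2 * I * s * v := by
  unfold eigenform; push_cast; ring

theorem norm_add_norm_le_eigenform {a u v : ℂ} {s σ a₀ s₀ : ℝ} (ha₀ : 0 < a₀) (hs₀ : 0 < s₀)
    (ha : a₀ ≤ ‖a‖) (hs : s₀ ≤ s) (hsσ : |s - σ| ≤ 1) :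
    ‖u‖ + ‖v‖ ≤ (1 / a₀ * (1 + 1 / s₀) + 1 / s₀) *
      (‖eigenform a s σ u v‖ + ‖eigenform a (-s) σ u v‖) := by
  set N := ‖eigenform a s σ u v‖ + ‖eigenform a (-s) σ u v‖ with hN
  have hN0 : 0 ≤ N := by positivity
  have hv : ‖v‖ ≤ 1 / s₀ * N := by
    have h1 : ‖2 * I * (s : ℂ) * v‖ ≤ N := by
      rw [← eigenform_sub_neg a u v s σ]; exact norm_sub_le _ _
    simp only [norm_mul, norm_I, Complex.norm_real, Real.norm_eq_abs, Complex.norm_ofNat,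
      abs_of_pos (hs₀.trans_le hs)] at h1
    rw [one_div, inv_mul_eq_div, le_div_iff₀ hs₀]
    nlinarith [norm_nonneg v, mul_le_mul_of_nonneg_right hs (norm_nonneg v)]
  have hu : ‖u‖ ≤ 1 / a₀ * (N + ‖v‖) := by
    have h1 : (starRingEnd ℂ) a * u = eigenform a s σ u v - I * ((s - σ : ℝ) : ℂ) * v := by
      unfold eigenform; push_cast; ring
    have h2 := congrArg norm h1
    have h3 := norm_sub_le (eigenform a s σ u v) (I * ((s - σ : ℝ) : ℂ) * v)
    rw [← h2] at h3
    simp only [norm_mul, norm_I, Complex.norm_real, Real.norm_eq_abs, RCLike.norm_conj,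
      one_mul] at h3
    rw [one_div, inv_mul_eq_div, le_div_iff₀ ha₀]
    nlinarith [norm_nonneg v, norm_nonneg u, mul_le_mul_of_nonneg_right ha (norm_nonneg u),
      mul_le_mul_of_nonneg_right hsσ (norm_nonneg v), norm_nonneg (eigenform a (-s) σ u v)]
  have h4 : 1 / a₀ * (N + ‖v‖) ≤ 1 / a₀ * (N + 1 / s₀ * N) := by gcongr
  calc ‖u‖ + ‖v‖ ≤ 1 / a₀ * (N + 1 / s₀ * N) + 1 / s₀ * N := by linarith
    _ = _ := by ring

theorem IsTransferSolution.norm_succ_le {α : ℤ → ℂ} {ρ : ℤ → ℝ} {lam : ℝ} {u v : ℤ → ℂ}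
    (h : IsTransferSolution α ρ lam u v) {x : ℤ} {s₀ : ℝ} (hs₀ : 0 < s₀) (hρ : s₀ ≤ ρ x)
    (hα : ‖α x‖ ≤ 1) :
    ‖u (x + 1)‖ + ‖v (x + 1)‖ ≤ 2 / s₀ * (‖u x‖ + ‖v x‖) := by
  have hρ0 : 0 < ρ x := hs₀.trans_le hρ
  have e2 : ‖Complex.exp (-(Complex.I * (lam : ℂ)))‖ = 1 := by
    simpa using norm_exp_I_mul_ofReal (-lam)
  have key : ∀ p q y z : ℂ, ‖p‖ ≤ 1 → ‖q‖ ≤ 1 →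
      ‖(ρ x : ℂ)⁻¹ * (p * y + q * z)‖ ≤ 1 / s₀ * (‖y‖ + ‖z‖) := by
    intro p q y z hp hq
    rw [norm_mul, norm_inv, Complex.norm_real, Real.norm_eq_abs, abs_of_pos hρ0, ← one_div]
    gcongr
    refine (norm_add_le _ _).trans ?_
    rw [norm_mul, norm_mul]
    gcongr
    · exact mul_le_of_le_one_left (norm_nonneg _) hp
    · exact mul_le_of_le_one_left (norm_nonneg _) hq
  rw [(h x).1, (h x).2]
  have h1 := key _ (α x) (u x) (v x) (norm_exp_I_mul_ofReal lam).le hα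
  have h2 := key ((starRingEnd ℂ) (α x)) _ (u x) (v x) (by simpa using hα) e2.le
  calc _ ≤ 1 / s₀ * (‖u x‖ + ‖v x‖) + 1 / s₀ * (‖u x‖ + ‖v x‖) := add_le_add h1 h2
    _ = _ := by ring

theorem exists_bound_of_le_one_add_mul {N c : ℕ → ℝ} (hN : ∀ n, 0 ≤ N n) (hc : ∀ n, 0 ≤ c n)
    (hs : Summable c) (h : ∀ n, N (n + 1) ≤ (1 + c n) * N n) : ∃ C, ∀ n, N n ≤ C := by
  have key : ∀ n, N n ≤ N 0 * Real.exp (∑ k ∈ Finset.range n, c k) := by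
    intro n
    induction n with
    | zero => simp
    | succ n ih =>
      rw [Finset.sum_range_succ, Real.exp_add]
      calc N (n + 1) ≤ (1 + c n) * N n := h n
        _ ≤ Real.exp (c n) * (N 0 * Real.exp (∑ k ∈ Finset.range n, c k)) := by
          gcongr
          · exact hN n
          · linarith [Real.add_one_le_exp (c n)]
        _ = _ := by ring
  refine ⟨N 0 * Real.exp (∑' k, c k), fun n => (key n).trans ?_⟩
  gcongr
  · exact hN 0
  · exact hs.sum_le_tsum _ fun i _ => hc i

theorem exists_bound_of_le_one_add_mul_int {N c : ℤ → ℝ} (r : ℕ) (hN : ∀ x, 0 ≤ N x)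
    (hc : ∀ x, 0 ≤ c x) (hs : Summable c)
    (hf : ∀ x : ℤ, (r : ℤ) ≤ |x| → (r : ℤ) ≤ |x + 1| → N (x + 1) ≤ (1 + c x) * N x)
    (hb : ∀ x : ℤ, (r : ℤ) ≤ |x| → (r : ℤ) ≤ |x + 1| → N x ≤ (1 + c x) * N (x + 1)) :
    ∃ C, ∀ x : ℤ, (r : ℤ) ≤ |x| → N x ≤ C := by
  obtain ⟨C₁, h₁⟩ := exists_bound_of_le_one_add_mul (N := fun n : ℕ => N (r + n))
    (c := fun n : ℕ => c (r + n)) (fun n => hN _) (fun n => hc _)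
    (hs.comp_injective (i := fun n : ℕ => (r : ℤ) + n) fun a b hab => by simpa using hab) (fun n => by
      have := hf (r + n) (by rw [abs_of_nonneg] <;> omega) (by rw [abs_of_nonneg] <;> omega)
      push_cast
      rwa [← add_assoc])
  obtain ⟨C₂, h₂⟩ := exists_bound_of_le_one_add_mul (N := fun n : ℕ => N (-r - n))
    (c := fun n : ℕ => c (-r - n - 1)) (fun n => hN _) (fun n => hc _)
    (hs.comp_injective (i := fun n : ℕ => -(r : ℤ) - n - 1) fun a b hab => by simpa using hab)
    (fun n => by
      have := hb (-r - n - 1) (by rw [abs_of_nonpos] <;> omega) (by rw [abs_of_nonpos] <;> omega)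
      push_cast
      rw [← sub_sub]
      simpa using this)
  refine ⟨max C₁ C₂, fun x hx => ?_⟩
  rcases le_abs.1 hx with h | h
  · obtain ⟨n, rfl⟩ := Int.le.dest h
    exact (h₁ n).trans (le_max_left _ _)
  · obtain ⟨n, hn⟩ := Int.le.dest h
    obtain rfl : x = -r - n := by omega
    exact (h₂ n).trans (le_max_right _ _)

theorem exists_tendsto_exp_mul {a : ℕ → ℂ} {θ d : ℕ → ℝ} (r : ℕ) (hd : Summable d)
    (h : ∀ n, r ≤ n → ‖a (n + 1) - Complex.exp (I * (θ n : ℂ)) * a n‖ ≤ d n) :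
    ∃ c, Tendsto (fun n => Complex.exp (I * ((-∑ k ∈ Finset.range n, θ k : ℝ) : ℂ)) * a n)
      atTop (nhds c) := by
  set b : ℕ → ℂ := fun n => Complex.exp (I * ((-∑ k ∈ Finset.range n, θ k : ℝ) : ℂ)) * a n with hb
  have hcs : CauchySeq fun n => b (n + r) := by
    refine cauchySeq_of_dist_le_of_summable (fun n => d (n + r)) (fun n => ?_)
      ((summable_nat_add_iff r).2 hd)
    rw [dist_comm, dist_eq_norm]
    have : b (n + 1 + r) - b (n + r)
        = Complex.exp (I * ((-∑ k ∈ Finset.range (n + r + 1), θ k : ℝ) : ℂ)) *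
          (a (n + r + 1) - Complex.exp (I * (θ (n + r) : ℂ)) * a (n + r)) := by
      simp only [hb]
      rw [show n + 1 + r = n + r + 1 by ring, mul_sub, ← mul_assoc, ← Complex.exp_add]
      congr 4
      rw [Finset.sum_range_succ]; push_cast; ring
    rw [Nat.succ_eq_add_one, this, norm_mul, norm_exp_I_mul_ofReal, one_mul]
    exact h _ (by omega)
  obtain ⟨c, hc⟩ := cauchySeq_tendsto_of_complete hcs
  exact ⟨c, (tendsto_add_atTop_iff_nat r).1 hc⟩

/-- At a site with coefficient `a` the transfer matrix has eigenvalues `exp (± i ζ)`, with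
quantitative lower bounds `a₀` on `‖a‖` and `s₀` on `s = ρ sin ζ`. -/
structure EllipticAt (a : ℂ) (ρ lam s ζ a₀ s₀ : ℝ) : Prop where
  le_norm : a₀ ≤ ‖a‖
  norm_le_one : ‖a‖ ≤ 1
  le_s : s₀ ≤ s
  le_rho : s₀ ≤ ρ
  sq_s : s ^ 2 = Real.sin lam ^ 2 - ‖a‖ ^ 2
  rho_mul_cos : ρ * Real.cos ζ = Real.cos lam
  rho_mul_sin : ρ * Real.sin ζ = s
  abs_sub_le : |s - Real.sin lam| ≤ 1

theorem EllipticAt.abs_sub_le_norm_sub {a b : ℂ} {ρ ρ' lam s s' ζ ζ' a₀ s₀ : ℝ} (hs₀ : 0 < s₀)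
    (h : EllipticAt a ρ lam s ζ a₀ s₀) (h' : EllipticAt b ρ' lam s' ζ' a₀ s₀) :
    |s - s'| ≤ 1 / s₀ * ‖a - b‖ := by
  rw [one_div, inv_mul_eq_div, le_div_iff₀ hs₀]
  have h1 : (s - s') * (s + s') = (‖b‖ - ‖a‖) * (‖b‖ + ‖a‖) := by
    linear_combination h.sq_s - h'.sq_s
  have h2 : |s - s'| * (s + s') ≤ ‖a - b‖ * 2 := by
    have h3 := congrArg abs h1
    rw [abs_mul, abs_mul, abs_of_pos (show 0 < s + s' by linarith [h.le_s, h'.le_s]),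
      abs_of_nonneg (show 0 ≤ ‖b‖ + ‖a‖ by positivity)] at h3
    rw [h3]
    have := abs_norm_sub_norm_le b a
    rw [norm_sub_rev] at this
    gcongr
    linarith [h.norm_le_one, h'.norm_le_one]
  nlinarith [abs_nonneg (s - s'), h.le_s, h'.le_s]

section

variable {α : ℤ → ℂ} {ρ s ζ : ℤ → ℝ} {lam a₀ s₀ : ℝ} {u v : ℤ → ℂ}

theorem IsTransferSolution.norm_eigenform_succ_sub_le
    (h : IsTransferSolution α ρ lam u v) (hs₀ : 0 < s₀) {x : ℤ}
    (hx : EllipticAt (α x) (ρ x) lam (s x) (ζ x) a₀ s₀)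
    (hx' : EllipticAt (α (x + 1)) (ρ (x + 1)) lam (s (x + 1)) (ζ (x + 1)) a₀ s₀) :
    ‖eigenform (α (x + 1)) (s (x + 1)) (Real.sin lam) (u (x + 1)) (v (x + 1))
        - Complex.exp (I * (ζ x : ℂ)) * eigenform (α x) (s x) (Real.sin lam) (u x) (v x)‖
      ≤ (1 + 1 / s₀) * ‖α (x + 1) - α x‖ * (‖u (x + 1)‖ + ‖v (x + 1)‖) ∧
    ‖eigenform (α (x + 1)) (-s (x + 1)) (Real.sin lam) (u (x + 1)) (v (x + 1))
        - Complex.exp (I * ((-ζ x : ℝ) : ℂ)) *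
          eigenform (α x) (-s x) (Real.sin lam) (u x) (v x)‖
      ≤ (1 + 1 / s₀) * ‖α (x + 1) - α x‖ * (‖u (x + 1)‖ + ‖v (x + 1)‖) := by
  have hL := hx'.abs_sub_le_norm_sub hs₀ hx
  have hρ0 := hs₀.trans_le hx.le_rho
  constructor
  · rw [← h.eigenform_step hρ0 hx.sq_s hx.rho_mul_cos hx.rho_mul_sin]
    refine (norm_eigenform_sub_le _ _ _ _ _ _ _).trans ?_
    gcongr
    linarith
  · rw [← h.eigenform_step hρ0 (t := -s x) (θ := -ζ x) (by rw [neg_sq, hx.sq_s])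
      (by rw [Real.cos_neg, hx.rho_mul_cos]) (by rw [Real.sin_neg, mul_neg, hx.rho_mul_sin])]
    refine (norm_eigenform_sub_le _ _ _ _ _ _ _).trans ?_
    rw [← neg_sub', abs_neg]
    gcongr
    linarith

theorem IsTransferSolution.exists_bound (h : IsTransferSolution α ρ lam u v)
    (hsum : Summable fun x : ℤ => ‖α (x + 1) - α x‖) (ha₀ : 0 < a₀) (hs₀ : 0 < s₀) {r : ℕ}
    (hell : ∀ x : ℤ, (r : ℤ) ≤ |x| → EllipticAt (α x) (ρ x) lam (s x) (ζ x) a₀ s₀) :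
    ∃ C, ∀ x, ‖u x‖ + ‖v x‖ ≤ C := by
  set N : ℤ → ℝ := fun x => ‖eigenform (α x) (s x) (Real.sin lam) (u x) (v x)‖
    + ‖eigenform (α x) (-s x) (Real.sin lam) (u x) (v x)‖ with hN
  set K := 1 + 1 / s₀ with hK
  set B := 1 / a₀ * (1 + 1 / s₀) + 1 / s₀ with hB
  have hK0 : 0 < K := by positivity
  have hB0 : 0 < B := by positivity
  have hMN : ∀ x : ℤ, (r : ℤ) ≤ |x| → ‖u x‖ + ‖v x‖ ≤ B * N x := fun x hx =>
    norm_add_norm_le_eigenform ha₀ hs₀ (hell x hx).le_norm (hell x hx).le_s (hell x hx).abs_sub_le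
  have hdiff : ∀ x : ℤ, (r : ℤ) ≤ |x| → (r : ℤ) ≤ |x + 1| →
      |N (x + 1) - N x| ≤ 2 * K * ‖α (x + 1) - α x‖ * (‖u (x + 1)‖ + ‖v (x + 1)‖) := by
    intro x hx hx'
    obtain ⟨h1, h2⟩ := h.norm_eigenform_succ_sub_le hs₀ (hell x hx) (hell _ hx')
    have h3 := (abs_norm_sub_norm_le _ _).trans h1
    have h4 := (abs_norm_sub_norm_le _ _).trans h2
    rw [norm_mul, Complex.norm_exp_I_mul_ofReal, one_mul] at h3 h4
    have h5 := abs_le.1 h3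
    have h6 := abs_le.1 h4
    simp only [hN]
    rw [abs_le]
    constructor <;> linarith
  obtain ⟨C, hC⟩ := exists_bound_of_le_one_add_mul_int (N := N)
    (c := fun x => (2 * K * B + 2 * K * (2 / s₀) * B) * ‖α (x + 1) - α x‖) r
    (fun x => by positivity) (fun x => by positivity) (hsum.mul_left _)
    (fun x hx hx' => by
      have h1 := (abs_le.1 (hdiff x hx hx')).2
      have h2 := h.norm_succ_le hs₀ (hell x hx).le_rho (hell x hx).norm_le_one
      have h3 : ‖u (x + 1)‖ + ‖v (x + 1)‖ ≤ 2 / s₀ * (B * N x) :=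
        h2.trans (by gcongr; exact hMN x hx)
      have h4 : 2 * K * ‖α (x + 1) - α x‖ * (‖u (x + 1)‖ + ‖v (x + 1)‖)
        ≤ 2 * K * ‖α (x + 1) - α x‖ * (2 / s₀ * (B * N x)) := by gcongr
      have h5 : 0 ≤ 2 * K * B * ‖α (x + 1) - α x‖ * N x := by positivity
      linarith)
    (fun x hx hx' => by
      have h1 := (abs_le.1 (hdiff x hx hx')).1
      have h4 : 2 * K * ‖α (x + 1) - α x‖ * (‖u (x + 1)‖ + ‖v (x + 1)‖)
        ≤ 2 * K * ‖α (x + 1) - α x‖ * (B * N (x + 1)) := by gcongr; exact hMN _ hx'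
      have h5 : 0 ≤ 2 * K * (2 / s₀) * B * ‖α (x + 1) - α x‖ * N (x + 1) := by positivity
      linarith)
  refine ⟨B * C + ∑ y ∈ Finset.Icc (-(r : ℤ)) r, (‖u y‖ + ‖v y‖), fun x => ?_⟩
  by_cases hx : (r : ℤ) ≤ |x|
  · have h1 : B * N x ≤ B * C := by gcongr; exact hC x hx
    have h2 : 0 ≤ ∑ y ∈ Finset.Icc (-(r : ℤ)) r, (‖u y‖ + ‖v y‖) := by positivity
    linarith [hMN x hx]
  · have hC0 : 0 ≤ C := (show 0 ≤ N r by positivity).trans (hC r (le_abs_self _))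
    have h1 : x ∈ Finset.Icc (-(r : ℤ)) r := by
      rw [Finset.mem_Icc, ← abs_le]; omega
    have h2 := Finset.single_le_sum (f := fun y => ‖u y‖ + ‖v y‖)
      (fun i _ => by positivity) h1
    have h3 : 0 ≤ B * C := by positivity
    linarith

theorem IsTransferSolution.exists_tendsto (h : IsTransferSolution α ρ lam u v)
    (hsum : Summable fun x : ℤ => ‖α (x + 1) - α x‖) (ha₀ : 0 < a₀) (hs₀ : 0 < s₀) {r : ℕ}
    (hell : ∀ x : ℤ, (r : ℤ) ≤ |x| → EllipticAt (α x) (ρ x) lam (s x) (ζ x) a₀ s₀) :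
    ∃ c d,
      Tendsto (fun n : ℕ => Complex.exp (I * ((-∑ k ∈ Finset.range n, ζ k : ℝ) : ℂ)) *
        eigenform (α n) (s n) (Real.sin lam) (u n) (v n)) atTop (nhds c) ∧
      Tendsto (fun n : ℕ => Complex.exp (I * ((∑ k ∈ Finset.range n, ζ k : ℝ) : ℂ)) *
        eigenform (α n) (-s n) (Real.sin lam) (u n) (v n)) atTop (nhds d) := by
  obtain ⟨C, hC⟩ := h.exists_bound hsum ha₀ hs₀ hell
  have hd : Summable fun n : ℕ => (1 + 1 / s₀) * ‖α ((n : ℤ) + 1) - α n‖ * C :=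
    ((hsum.comp_injective (i := fun n : ℕ => (n : ℤ)) Nat.cast_injective).mul_left _).mul_right _
  have hstep : ∀ n : ℕ, r ≤ n → _ := fun n hn => h.norm_eigenform_succ_sub_le hs₀ (x := (n : ℤ))
    (hell n (by rw [abs_of_nonneg] <;> omega)) (hell _ (by rw [abs_of_nonneg] <;> omega))
  have hle : ∀ n : ℕ, (1 + 1 / s₀) * ‖α ((n : ℤ) + 1) - α n‖ *
      (‖u ((n : ℤ) + 1)‖ + ‖v ((n : ℤ) + 1)‖) ≤ (1 + 1 / s₀) * ‖α ((n : ℤ) + 1) - α n‖ * C :=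
    fun n => by gcongr; exact hC _
  obtain ⟨c, hc⟩ := exists_tendsto_exp_mul (θ := fun n : ℕ => ζ n)
    (a := fun n : ℕ => eigenform (α n) (s n) (Real.sin lam) (u n) (v n)) r hd
    fun n hn => by simpa only [Nat.cast_add, Nat.cast_one] using (hstep n hn).1.trans (hle n)
  obtain ⟨d, hd'⟩ := exists_tendsto_exp_mul (θ := fun n : ℕ => -ζ n)
    (a := fun n : ℕ => eigenform (α n) (-s n) (Real.sin lam) (u n) (v n)) r hd
    fun n hn => by simpa only [Nat.cast_add, Nat.cast_one] using (hstep n hn).2.trans (hle n)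
  simp only [Finset.sum_neg_distrib, neg_neg] at hd'
  exact ⟨c, d, hc, hd'⟩

end

theorem IsTransferSolution.mul_add_mul {α : ℤ → ℂ} {ρ : ℤ → ℝ} {lam : ℝ}
    {u₁ v₁ u₂ v₂ : ℤ → ℂ} (h₁ : IsTransferSolution α ρ lam u₁ v₁)
    (h₂ : IsTransferSolution α ρ lam u₂ v₂) (p q : ℂ) :
    IsTransferSolution α ρ lam (fun x => p * u₁ x + q * u₂ x) (fun x => p * v₁ x + q * v₂ x) := by
  intro x
  simp only [(h₁ x).1, (h₁ x).2, (h₂ x).1, (h₂ x).2]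
  constructor <;> ring

theorem exists_transferSolution_tendsto {α : ℤ → ℂ} {ρ s ζ : ℤ → ℝ} {lam a₀ s₀ sp : ℝ} {αp : ℂ}
    (hρ0 : ∀ x, 0 < ρ x) (hρ2 : ∀ x, ρ x ^ 2 = 1 - ‖α x‖ ^ 2)
    (hsum : Summable fun x : ℤ => ‖α (x + 1) - α x‖) (ha₀ : 0 < a₀) (hs₀ : 0 < s₀) {r : ℕ}
    (hell : ∀ x : ℤ, (r : ℤ) ≤ |x| → EllipticAt (α x) (ρ x) lam (s x) (ζ x) a₀ s₀)
    (htop : Tendsto α atTop (nhds αp)) (hs : Tendsto s atTop (nhds sp)) (hαp : αp ≠ 0)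
    (hsp : 0 < sp) (hsp2 : sp ^ 2 = Real.sin lam ^ 2 - ‖αp‖ ^ 2) :
    ∃ u v : ℤ → ℂ, IsTransferSolution α ρ lam u v ∧ (∃ C, ∀ x, ‖u x‖ + ‖v x‖ ≤ C) ∧
      (∀ x, u x = 0 → v x ≠ 0) ∧
      Tendsto (fun n : ℕ => Complex.exp (I * ((-∑ k ∈ Finset.range n, ζ k : ℝ) : ℂ)) * u n)
        atTop (nhds αp) ∧
      Tendsto (fun n : ℕ => Complex.exp (I * ((-∑ k ∈ Finset.range n, ζ k : ℝ) : ℂ)) * v n)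
        atTop (nhds (I * ((sp : ℂ) - Real.sin lam))) := by
  obtain ⟨u₁, v₁, u₂, v₂, h₁, h₂, hdet⟩ := exists_transferSolution_pair α ρ lam hρ0 hρ2
  obtain ⟨c₁, d₁, hc₁, hd₁⟩ := h₁.exists_tendsto hsum ha₀ hs₀ hell
  obtain ⟨c₂, d₂, hc₂, hd₂⟩ := h₂.exists_tendsto hsum ha₀ hs₀ hell
  have hcast : Tendsto (fun n : ℕ => (n : ℤ)) atTop atTop := tendsto_natCast_atTop_atTop
  have hαn := htop.comp hcast
  have hsn : Tendsto (fun n : ℕ => (s n : ℂ)) atTop (nhds (sp : ℂ)) :=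
    (Complex.continuous_ofReal.tendsto sp).comp (hs.comp hcast)
  have hαcn : Tendsto (fun n : ℕ => (starRingEnd ℂ) (α n)) atTop (nhds ((starRingEnd ℂ) αp)) :=
    (Complex.continuous_conj.tendsto αp).comp hαn
  have hsp0 : (sp : ℂ) ≠ 0 := by exact_mod_cast hsp.ne'
  have hαc0 : (starRingEnd ℂ) αp ≠ 0 := by simpa using hαp
  have hexp : ∀ n : ℕ, Complex.exp (I * ((-∑ k ∈ Finset.range n, ζ k : ℝ) : ℂ)) *
      Complex.exp (I * ((∑ k ∈ Finset.range n, ζ k : ℝ) : ℂ)) = 1 := fun n => by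
    rw [← Complex.exp_add]; push_cast; simp
  have hD : c₁ * d₂ - c₂ * d₁ = (starRingEnd ℂ) αp * (-2 * I * sp) := by
    refine tendsto_nhds_unique ((hc₁.mul hd₂).sub (hc₂.mul hd₁)) ?_
    refine (hαcn.mul (hsn.const_mul (-2 * I))).congr fun n => ?_
    have h1 := hexp n
    have h2 := hdet n
    unfold eigenform
    push_cast at h1 ⊢
    linear_combination (-2 * I * s n * (starRingEnd ℂ) (α n)) * (-(u₁ n * v₂ n - u₂ n * v₁ n) * h1
      - h2)
  have hD0 : c₁ * d₂ - c₂ * d₁ ≠ 0 := by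
    rw [hD]
    exact mul_ne_zero hαc0 (mul_ne_zero (by simp) hsp0)
  have hnorm : (starRingEnd ℂ) αp * αp = (Real.sin lam : ℂ) ^ 2 - (sp : ℂ) ^ 2 := by
    rw [mul_comm, Complex.mul_conj, Complex.normSq_eq_norm_sq,
      show ‖αp‖ ^ 2 = Real.sin lam ^ 2 - sp ^ 2 by linarith]
    push_cast; ring
  set c : ℂ := 2 * sp * (Real.sin lam - sp) with hc
  have hc0 : c ≠ 0 := by
    have : (Real.sin lam : ℂ) - sp ≠ 0 := by
      intro h0
      rw [sub_eq_zero] at h0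
      rw [h0, sub_self] at hnorm
      exact mul_ne_zero hαc0 hαp hnorm
    exact mul_ne_zero (mul_ne_zero two_ne_zero hsp0) this
  set D := c₁ * d₂ - c₂ * d₁
  set p : ℂ := c * d₂ / D with hp
  set q : ℂ := -(c * d₁ / D) with hq
  have hpq1 : p * c₁ + q * c₂ = c := by
    rw [hp, hq]; field_simp; simp only [D]; ring
  have hpq2 : p * d₁ + q * d₂ = 0 := by
    rw [hp, hq]; ring
  have hsol := h₁.mul_add_mul h₂ p q
  have hplus := (hc₁.const_mul p).add (hc₂.const_mul q)
  have hminus := (hd₁.const_mul p).add (hd₂.const_mul q)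
  rw [hpq1] at hplus
  rw [hpq2] at hminus
  have hminus' : Tendsto (fun n : ℕ => Complex.exp (I * ((-∑ k ∈ Finset.range n, ζ k : ℝ) : ℂ)) *
      eigenform (α n) (-s n) (Real.sin lam) (p * u₁ n + q * u₂ n) (p * v₁ n + q * v₂ n))
      atTop (nhds 0) := by
    rw [tendsto_zero_iff_norm_tendsto_zero] at hminus ⊢
    refine hminus.congr fun n => ?_
    have : ∀ y : ℂ, ‖Complex.exp (I * ((-∑ k ∈ Finset.range n, ζ k : ℝ) : ℂ)) * y‖
        = ‖Complex.exp (I * ((∑ k ∈ Finset.range n, ζ k : ℝ) : ℂ)) * y‖ := fun y => by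
      rw [norm_mul, norm_mul, Complex.norm_exp_I_mul_ofReal, Complex.norm_exp_I_mul_ofReal]
    rw [this]
    congr 1
    unfold eigenform
    ring
  have hsn0 : ∀ᶠ n : ℕ in atTop, (s n : ℂ) ≠ 0 := hsn.eventually_ne hsp0
  have hαn0 : ∀ᶠ n : ℕ in atTop, (starRingEnd ℂ) (α n) ≠ 0 := hαcn.eventually_ne hαc0
  have hv : Tendsto (fun n : ℕ => Complex.exp (I * ((-∑ k ∈ Finset.range n, ζ k : ℝ) : ℂ)) *
      (p * v₁ n + q * v₂ n)) atTop (nhds (I * ((sp : ℂ) - Real.sin lam))) := by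
    have h1 := (hplus.sub hminus').div (hsn.const_mul (2 * I)) (mul_ne_zero (by simp) hsp0)
    have h2 : (c - 0) / (2 * I * sp) = I * ((sp : ℂ) - Real.sin lam) := by
      rw [div_eq_iff (mul_ne_zero (by simp) hsp0), hc]
      linear_combination (-2 * sp * ((sp : ℂ) - Real.sin lam)) * I_sq
    rw [h2] at h1
    refine h1.congr' ?_
    filter_upwards [hsn0] with n hn
    simp only [Pi.div_apply]
    rw [div_eq_iff (mul_ne_zero (by simp) hn)]
    unfold eigenform
    push_cast
    ring
  have hu : Tendsto (fun n : ℕ => Complex.exp (I * ((-∑ k ∈ Finset.range n, ζ k : ℝ) : ℂ)) *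
      (p * u₁ n + q * u₂ n)) atTop (nhds αp) := by
    have h1 := (hplus.sub (((hsn.sub_const (Real.sin lam : ℂ)).const_mul I).mul hv)).div hαcn hαc0
    have h2 : (c - I * ((sp : ℂ) - Real.sin lam) * (I * ((sp : ℂ) - Real.sin lam)))
        / (starRingEnd ℂ) αp = αp := by
      rw [div_eq_iff hαc0, hc]
      linear_combination (-((sp : ℂ) - Real.sin lam) ^ 2) * I_sq - hnorm
    rw [h2] at h1
    refine h1.congr' ?_
    filter_upwards [hαn0] with n hn
    simp only [Pi.div_apply]
    rw [div_eq_iff hn]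
    unfold eigenform
    ring
  refine ⟨_, _, hsol, hsol.exists_bound hsum ha₀ hs₀ hell, fun x hux hvx => ?_, hu, hv⟩
  have hp0 : p = 0 := by linear_combination v₂ x * hux - u₂ x * hvx - p * hdet x
  have hq0 : q = 0 := by linear_combination u₁ x * hvx - v₁ x * hux - q * hdet x
  rw [hp0, hq0] at hpq1
  exact hc0 (by simpa using hpq1.symm)

theorem ellipticAt_arccos {a : ℂ} {ρ lam a₀ s₀ : ℝ} (hs₀ : 0 < s₀) (hlam : 0 ≤ Real.sin lam)
    (hρ0 : 0 < ρ) (hρ2 : ρ ^ 2 = 1 - ‖a‖ ^ 2) (ha : a₀ ≤ ‖a‖)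
    (hs : s₀ ≤ Real.sqrt (Real.sin lam ^ 2 - ‖a‖ ^ 2)) :
    EllipticAt a ρ lam (Real.sqrt (Real.sin lam ^ 2 - ‖a‖ ^ 2))
      (Real.arccos (Real.cos lam / ρ)) a₀ s₀ ∧
    Real.arccos (Real.cos lam / ρ) ∈ Set.Ioo 0 Real.pi := by
  set s := Real.sqrt (Real.sin lam ^ 2 - ‖a‖ ^ 2) with hsdef
  have hspos : 0 < s := hs₀.trans_le hs
  have hs2 : s ^ 2 = Real.sin lam ^ 2 - ‖a‖ ^ 2 := Real.sq_sqrt (Real.sqrt_pos.1 hspos).le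
  have hs2' : s ^ 2 = ρ ^ 2 - Real.cos lam ^ 2 := by
    linarith [Real.sin_sq_add_cos_sq lam]
  have hlt : |Real.cos lam| < ρ := abs_lt_of_sq_lt_sq (by nlinarith) hρ0.le
  obtain ⟨hlt1, hlt2⟩ := abs_lt.1 hlt
  have h1 : -1 < Real.cos lam / ρ := by rw [lt_div_iff₀ hρ0]; linarith
  have h2 : Real.cos lam / ρ < 1 := by rw [div_lt_iff₀ hρ0]; linarith
  have hmem : Real.arccos (Real.cos lam / ρ) ∈ Set.Ioo 0 Real.pi :=
    ⟨Real.arccos_pos.2 h2, lt_of_le_of_ne (Real.arccos_le_pi _) fun h => by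
      rw [Real.arccos_eq_pi] at h; linarith⟩
  have hcos : ρ * Real.cos (Real.arccos (Real.cos lam / ρ)) = Real.cos lam := by
    rw [Real.cos_arccos h1.le h2.le]; field_simp
  have hsσ : s ≤ Real.sin lam := abs_le_of_sq_le_sq' (by nlinarith [sq_nonneg ‖a‖]) hlam |>.2
  refine ⟨⟨ha, ?_, hs, ?_, hs2, hcos, ?_, ?_⟩, hmem⟩
  · nlinarith [norm_nonneg a]
  · exact hs.trans (abs_le_of_sq_le_sq' (by nlinarith [sq_nonneg (Real.cos lam)]) hρ0.le).2
  · have hsin := Real.sin_pos_of_mem_Ioo hmem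
    rw [← sq_eq_sq₀ (by positivity) hspos.le, mul_pow, Real.sin_sq, hs2']
    have hcos2 := congrArg (· ^ 2) hcos
    simp only [mul_pow] at hcos2
    linarith
  · rw [abs_le]
    constructor <;> linarith [Real.sin_le_one lam]

theorem exists_forall_le_abs {P : ℤ → Prop} (h₁ : ∀ᶠ x in atTop, P x) (h₂ : ∀ᶠ x in atBot, P x) :
    ∃ r : ℕ, ∀ x : ℤ, (r : ℤ) ≤ |x| → P x := by
  obtain ⟨a, ha⟩ := eventually_atTop.1 h₁
  obtain ⟨b, hb⟩ := eventually_atBot.1 h₂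
  refine ⟨max a.natAbs b.natAbs, fun x hx => ?_⟩
  rcases le_abs.1 hx with h | h
  · exact ha x (by omega)
  · exact hb x (by omega)

/-- Existence of a modified plane wave (Jost solution): a bounded, nowhere vanishing
solution `φ` of the transfer-matrix recursion with asymptotics
`φ(x) ∼ e^{iZ(x)} ν₊` as `x → +∞`, where `Z(x) = ∑_{y=0}^{x−1} ζ(y)` is built from
the modified frequency `ζ`. -/
theorem jost_solution_exists
    (α : ℤ → ℂ)
    (h01 : ∀ x : ℤ, 0 < ‖α x‖) (h02 : ∀ x : ℤ, ‖α x‖ < 1)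
    (hsum : Summable fun x : ℤ => ‖α (x + 1) - α x‖)
    (αp αm : ℂ)
    (htop : Tendsto α atTop (nhds αp))
    (hbot : Tendsto α atBot (nhds αm))
    (hpm : ‖αp‖ = ‖αm‖) (h0p : 0 < ‖αp‖) (h1p : ‖αp‖ < 1)
    (ρ : ℤ → ℝ) (hρ : ∀ x : ℤ, ρ x = Real.sqrt (1 - ‖α x‖ ^ 2))
    (ρinf : ℝ) (hρinf : ρinf = Real.sqrt (1 - ‖αp‖ ^ 2))
    (ξ : ℝ) (hξ : ξ ∈ Set.Ioo 0 Real.pi)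
    (lam : ℝ) (hlam : lam = Real.arccos (ρinf * Real.cos ξ)) :
    ∃ r : ℕ, ∃ ζ : ℤ → ℝ, ∃ φ : ℤ → ℂ × ℂ,
      (∀ x : ℤ, |x| < (r : ℤ) → ζ x = ξ) ∧
      (∀ x : ℤ, (r : ℤ) ≤ |x| →
        ζ x ∈ Set.Ioo 0 Real.pi ∧ ρ x * Real.cos (ζ x) = ρinf * Real.cos ξ) ∧
      Tendsto ζ atTop (nhds ξ) ∧ Tendsto ζ atBot (nhds ξ) ∧
      (∀ x : ℤ, φ (x + 1)
        = ((ρ x : ℂ)⁻¹ * (Complex.exp (Complex.I * (lam : ℂ)) * (φ x).1 + α x * (φ x).2),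
            (ρ x : ℂ)⁻¹ * ((starRingEnd ℂ) (α x) * (φ x).1
              + Complex.exp (-(Complex.I * (lam : ℂ))) * (φ x).2))) ∧
      (∃ C : ℝ, ∀ x : ℤ, ‖φ x‖ ≤ C) ∧
      Tendsto
        (fun x : ℤ =>
          ‖φ x - Complex.exp (Complex.I * ((∑ y ∈ Finset.range x.toNat, ζ (y : ℤ) : ℝ) : ℂ)) •
            (((αp, (ρinf : ℂ) * Complex.exp (Complex.I * (ξ : ℂ))
                - Complex.exp (Complex.I * (lam : ℂ))) : ℂ × ℂ))‖)
        atTop (nhds 0) ∧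
      (∀ x : ℤ, φ x ≠ 0) := by
  have hρ2 : ∀ x, ρ x ^ 2 = 1 - ‖α x‖ ^ 2 := fun x => by
    rw [hρ, Real.sq_sqrt]; nlinarith [h02 x, norm_nonneg (α x)]
  have hρ0 : ∀ x, 0 < ρ x := fun x => by
    rw [hρ, Real.sqrt_pos]; nlinarith [h02 x, norm_nonneg (α x)]
  have hρi2 : ρinf ^ 2 = 1 - ‖αp‖ ^ 2 := by
    rw [hρinf, Real.sq_sqrt]; nlinarith
  have hρi0 : 0 < ρinf := by
    rw [hρinf, Real.sqrt_pos]; nlinarith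
  have hcos : Real.cos lam = ρinf * Real.cos ξ := by
    have h1 : |ρinf * Real.cos ξ| ≤ 1 := by
      rw [abs_le_one_iff_mul_self_le_one]
      nlinarith [Real.cos_sq_le_one ξ, sq_nonneg (Real.cos ξ)]
    rw [hlam, Real.cos_arccos (abs_le.1 h1).1 (abs_le.1 h1).2]
  have hsin0 : 0 ≤ Real.sin lam := by
    rw [hlam]
    exact Real.sin_nonneg_of_nonneg_of_le_pi (Real.arccos_nonneg _) (Real.arccos_le_pi _)
  have hsinξ := Real.sin_pos_of_mem_Ioo hξ
  set sp : ℝ := ρinf * Real.sin ξ with hsp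
  have hsp0 : 0 < sp := by positivity
  have hsp2 : sp ^ 2 = Real.sin lam ^ 2 - ‖αp‖ ^ 2 := by
    rw [hsp, mul_pow, Real.sin_sq lam, hcos, Real.sin_sq]
    linear_combination hρi2
  set s : ℤ → ℝ := fun x => Real.sqrt (Real.sin lam ^ 2 - ‖α x‖ ^ 2) with hs
  have hlim : ∀ {l : Filter ℤ} {β : ℂ}, Tendsto α l (nhds β) → ‖αp‖ = ‖β‖ →
      Tendsto (fun x => ‖α x‖) l (nhds ‖αp‖) ∧ Tendsto s l (nhds sp) ∧
      Tendsto (fun x => Real.arccos (Real.cos lam / ρ x)) l (nhds ξ) := by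
    intro l β hβ hnorm
    have h1 : Tendsto (fun x => ‖α x‖) l (nhds ‖αp‖) := hnorm ▸ hβ.norm
    have h2 : Tendsto s l (nhds sp) := by
      rw [← Real.sqrt_sq hsp0.le, hsp2]
      exact ((h1.pow 2).const_sub _).sqrt
    have h3 : Tendsto ρ l (nhds ρinf) := by
      rw [funext hρ, hρinf]
      exact ((h1.pow 2).const_sub _).sqrt
    refine ⟨h1, h2, ?_⟩
    have h4 : Real.arccos (Real.cos lam / ρinf) = ξ := by
      rw [hcos, mul_div_cancel_left₀ _ hρi0.ne', Real.arccos_cos hξ.1.le hξ.2.le]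
    rw [← h4]
    exact (Real.continuous_arccos.tendsto _).comp (tendsto_const_nhds.div h3 hρi0.ne')
  obtain ⟨ht1, ht2, ht3⟩ := hlim htop rfl
  obtain ⟨hb1, hb2, hb3⟩ := hlim hbot hpm
  obtain ⟨r, hr⟩ := exists_forall_le_abs
    ((ht1.eventually_const_le (half_lt_self h0p)).and (ht2.eventually_const_le (half_lt_self hsp0)))
    ((hb1.eventually_const_le (half_lt_self h0p)).and (hb2.eventually_const_le (half_lt_self hsp0)))
  set ζ : ℤ → ℝ := fun x => if |x| < (r : ℤ) then ξ else Real.arccos (Real.cos lam / ρ x) with hζ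
  have hζr : ∀ x : ℤ, (r : ℤ) ≤ |x| → ζ x = Real.arccos (Real.cos lam / ρ x) := fun x hx =>
    if_neg (not_lt.2 hx)
  have hell : ∀ x : ℤ, (r : ℤ) ≤ |x| →
      EllipticAt (α x) (ρ x) lam (s x) (ζ x) (‖αp‖ / 2) (sp / 2) ∧ ζ x ∈ Set.Ioo 0 Real.pi := by
    intro x hx
    rw [hζr x hx]
    exact ellipticAt_arccos (half_pos hsp0) hsin0 (hρ0 x) (hρ2 x) (hr x hx).1 (hr x hx).2
  obtain ⟨u, v, hsol, ⟨C, hC⟩, hne, hu, hv⟩ := exists_transferSolution_tendsto hρ0 hρ2 hsum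
    (half_pos h0p) (half_pos hsp0) (fun x hx => (hell x hx).1) htop ht2 (norm_pos_iff.1 h0p)
    hsp0 hsp2
  refine ⟨r, ζ, fun x => (u x, v x), fun x hx => if_pos hx,
    fun x hx => ⟨(hell x hx).2, (hell x hx).1.rho_mul_cos.trans hcos⟩, ?_, ?_,
    fun x => Prod.ext (hsol x).1 (hsol x).2, ⟨C, fun x => ?_⟩, ?_, fun x hx => ?_⟩
  · refine ht3.congr' ?_
    filter_upwards [eventually_ge_atTop (r : ℤ)] with x hx
    exact (hζr x (hx.trans (le_abs_self x))).symm
  · refine hb3.congr' ?_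
    filter_upwards [eventually_le_atBot (-(r : ℤ))] with x hx
    exact (hζr x ((le_neg_of_le_neg hx).trans (neg_le_abs x))).symm
  · rw [Prod.norm_mk]
    exact (max_le_add_of_nonneg (norm_nonneg _) (norm_nonneg _)).trans (hC x)
  · rw [← Nat.map_cast_int_atTop, tendsto_map'_iff]
    have hν : (ρinf : ℂ) * Complex.exp (Complex.I * (ξ : ℂ)) - Complex.exp (Complex.I * (lam : ℂ))
        = I * ((sp : ℂ) - Real.sin lam) := by
      rw [exp_I_mul_ofReal, exp_I_mul_ofReal, hcos, hsp]
      push_cast; ring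
    rw [hν]
    have h1 := (tendsto_iff_norm_sub_tendsto_zero).1 (hu.prodMk_nhds hv)
    refine h1.congr fun n => ?_
    simp only [Function.comp_apply, Int.toNat_natCast]
    set Z : ℝ := ∑ k ∈ Finset.range n, ζ k
    have h2 : Complex.exp (I * ((-Z : ℝ) : ℂ)) * Complex.exp (I * (Z : ℂ)) = 1 := by
      rw [← Complex.exp_add]; push_cast; simp
    rw [← one_mul ‖(u n, v n) - _‖, ← Complex.norm_exp_I_mul_ofReal (-Z), ← norm_smul, smul_sub,
      smul_smul, h2, one_smul]
    rfl
  · exact hne x (congrArg Prod.fst hx) (congrArg Prod.snd hx)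
end

section
/- Spectrum of the translation-invariant quantum walk: let α₀ ∈ ℂ with 0 < |α₀| < 1 and ρ₀ = √(1 − |α₀|²). There is a bounded linear operator U₀ on the Hilbert space ℓ²(ℤ, ℂ²) such that for every u ∈ ℓ²(ℤ, ℂ²) and every x ∈ ℤ, (U₀u)(x) = (ρ₀·u₁(x−1) + conj(α₀)·u₂(x−1), −α₀·u₁(x+1) + ρ₀·u₂(x+1)). The operator U₀ is unitary, and its spectrum equals {z ∈ ℂ : |z| = 1 and |Re z| ≤ ρ₀}. -/
open Complex Filter

theorem sum_rpow_norm_map_shift_le {E : Type*} [NormedAddCommGroup E] [NormedSpace ℂ E]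
    (A : E →L[ℂ] E) (k : ℤ) (u : lp (fun _ : ℤ => E) 2) (s : Finset ℤ) :
    ∑ x ∈ s, ‖A (u (x + k))‖ ^ (2 : ENNReal).toReal
      ≤ (‖A‖ * ‖u‖) ^ (2 : ENNReal).toReal := by
  calc ∑ x ∈ s, ‖A (u (x + k))‖ ^ (2 : ENNReal).toReal
      ≤ ∑ x ∈ s, ‖A‖ ^ (2 : ENNReal).toReal * ‖u (x + k)‖ ^ (2 : ENNReal).toReal := by
        refine Finset.sum_le_sum fun x _ => ?_
        rw [← Real.mul_rpow (norm_nonneg _) (norm_nonneg _)]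
        exact Real.rpow_le_rpow (norm_nonneg _) (A.le_opNorm _) (by simp)
    _ = ‖A‖ ^ (2 : ENNReal).toReal *
          ∑ y ∈ s.map (Equiv.addRight k).toEmbedding, ‖u y‖ ^ (2 : ENNReal).toReal := by
        simp [Finset.mul_sum]
    _ ≤ ‖A‖ ^ (2 : ENNReal).toReal * ‖u‖ ^ (2 : ENNReal).toReal := by
        gcongr
        exact lp.sum_rpow_le_norm_rpow (by simp) u _
    _ = (‖A‖ * ‖u‖) ^ (2 : ENNReal).toReal :=
        (Real.mul_rpow (norm_nonneg _) (norm_nonneg _)).symm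

/-- The bounded operator on `ℓ²(ℤ, E)` that translates the argument by `k` and applies `A`
pointwise. -/
noncomputable def shiftMap {E : Type*} [NormedAddCommGroup E] [NormedSpace ℂ E]
    (A : E →L[ℂ] E) (k : ℤ) :
    lp (fun _ : ℤ => E) 2 →L[ℂ] lp (fun _ : ℤ => E) 2 :=
  LinearMap.mkContinuous
    { toFun := fun u => ⟨fun x => A (u (x + k)), memℓp_gen' (sum_rpow_norm_map_shift_le A k u)⟩
      map_add' := fun u v => lp.ext (funext fun x => map_add A (u (x + k)) (v (x + k)))
      map_smul' := fun c u => lp.ext (funext fun x => map_smul A c (u (x + k))) }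
    ‖A‖ fun u => lp.norm_le_of_forall_sum_le (by simp) (by positivity)
      (sum_rpow_norm_map_shift_le A k u)

namespace shiftMap

variable {E : Type*} [NormedAddCommGroup E] [NormedSpace ℂ E]

@[simp]
theorem apply_apply (A : E →L[ℂ] E) (k : ℤ) (u : lp (fun _ : ℤ => E) 2) (x : ℤ) :
    shiftMap A k u x = A (u (x + k)) := rfl

theorem norm_le (A : E →L[ℂ] E) (k : ℤ) : ‖shiftMap A k‖ ≤ ‖A‖ :=
  LinearMap.mkContinuous_norm_le _ (norm_nonneg A) _

theorem mul_eq (A B : E →L[ℂ] E) (j k : ℤ) :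
    shiftMap A j * shiftMap B k = shiftMap (A * B) (j + k) := by
  ext u x
  simp [add_assoc]

theorem add_eq (A B : E →L[ℂ] E) (k : ℤ) :
    shiftMap A k + shiftMap B k = shiftMap (A + B) k := by
  ext u x
  simp

theorem zero_eq (k : ℤ) : shiftMap (0 : E →L[ℂ] E) k = 0 := by
  ext u x
  simp

theorem one_zero : shiftMap (1 : E →L[ℂ] E) 0 = 1 := by
  ext u x
  simp

theorem apply_single (A : E →L[ℂ] E) (k x : ℤ) (v : E) :
    shiftMap A k (lp.single 2 x v) = lp.single 2 (x - k) (A v) := by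
  ext y
  rw [apply_apply, lp.single_apply, lp.single_apply]
  rcases eq_or_ne y (x - k) with rfl | h
  · rw [Pi.single_eq_same, sub_add_cancel, Pi.single_eq_same]
  · rw [Pi.single_eq_of_ne h, Pi.single_eq_of_ne (by grind), map_zero]

theorem star_eq {E : Type*} [NormedAddCommGroup E] [InnerProductSpace ℂ E] [CompleteSpace E]
    (A : E →L[ℂ] E) (k : ℤ) :
    star (shiftMap A k) = shiftMap (star A) (-k) := by
  rw [ContinuousLinearMap.star_eq_adjoint, ContinuousLinearMap.star_eq_adjoint]
  symm
  rw [ContinuousLinearMap.eq_adjoint_iff]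
  intro u v
  rw [lp.inner_eq_tsum, lp.inner_eq_tsum, ← (Equiv.addRight k).tsum_eq]
  refine tsum_congr fun x => ?_
  simp [ContinuousLinearMap.adjoint_inner_left]

end shiftMap

theorem isUnit_sub_of_isUnit_add_star_sub {A : Type*} [Ring A] [StarRing A] [Algebra ℂ A]
    {U : A} (hU : U ∈ unitary A) {z : ℂ} (hz : ‖z‖ = 1)
    (h : IsUnit (algebraMap ℂ A ((2 * z.re : ℝ) : ℂ) - (U + star U))) :
    IsUnit (algebraMap ℂ A z - U) := by
  have h1 : U * star U = 1 := (Unitary.mem_iff.1 hU).2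
  have h2 : star U * U = 1 := (Unitary.mem_iff.1 hU).1
  have hzz : z * (starRingEnd ℂ) z = 1 := by
    rw [Complex.mul_conj, Complex.normSq_eq_norm_sq, hz]; simp
  have hre : ((2 * z.re : ℝ) : ℂ) = z + (starRingEnd ℂ) z := (Complex.add_conj z).symm
  have hzz' : algebraMap ℂ A z * algebraMap ℂ A ((starRingEnd ℂ) z) = 1 := by
    rw [← map_mul, hzz, map_one]
  have hc (w : ℂ) (a : A) : a * algebraMap ℂ A w = algebraMap ℂ A w * a :=
    (Algebra.commutes w a).symm
  have e1 : (algebraMap ℂ A z - U) * (1 - algebraMap ℂ A ((starRingEnd ℂ) z) * star U)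
      = algebraMap ℂ A ((2 * z.re : ℝ) : ℂ) - (U + star U) := by
    rw [hre, map_add]
    have : U * (algebraMap ℂ A ((starRingEnd ℂ) z) * star U)
        = algebraMap ℂ A ((starRingEnd ℂ) z) := by
      rw [← mul_assoc, hc, mul_assoc, h1, mul_one]
    rw [mul_sub, sub_mul, sub_mul, this, ← mul_assoc, hzz']
    noncomm_ring
  have e2 : (1 - algebraMap ℂ A ((starRingEnd ℂ) z) * star U) * (algebraMap ℂ A z - U)
      = algebraMap ℂ A ((2 * z.re : ℝ) : ℂ) - (U + star U) := by
    rw [hre, map_add]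
    have : algebraMap ℂ A ((starRingEnd ℂ) z) * star U * algebraMap ℂ A z = star U := by
      rw [hc, ← mul_assoc, hzz', one_mul]
    rw [sub_mul, mul_sub, mul_sub, this, mul_assoc _ (star U) U, h2]
    noncomm_ring
  have hcomm : Commute (algebraMap ℂ A z - U)
      (1 - algebraMap ℂ A ((starRingEnd ℂ) z) * star U) := e1.trans e2.symm
  rw [← e1, hcomm.isUnit_mul_iff] at h
  exact h.1

theorem not_isUnit_of_forall_exists_norm_le {H : Type*} [NormedAddCommGroup H] [NormedSpace ℂ H]
    {T : H →L[ℂ] H} {M : ℝ} {c : ℝ} (hc : 0 < c)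
    (h : ∀ n : ℕ, ∃ u : H, ‖u‖ ^ 2 = n * c ∧ ‖T u‖ ≤ M) : ¬ IsUnit T := by
  rintro ⟨S, rfl⟩
  obtain ⟨n, hn⟩ := exists_nat_gt ((‖(↑S⁻¹ : H →L[ℂ] H)‖ * M) ^ 2 / c)
  obtain ⟨u, hu, hT⟩ := h n
  have e : (↑S⁻¹ : H →L[ℂ] H) ((S : H →L[ℂ] H) u) = u := by
    rw [← mul_apply_eq_comp, Units.inv_mul, one_apply_eq_self]
  have hle : ‖u‖ ≤ ‖(↑S⁻¹ : H →L[ℂ] H)‖ * M := by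
    calc ‖u‖ = ‖(↑S⁻¹ : H →L[ℂ] H) ((S : H →L[ℂ] H) u)‖ := by rw [e]
      _ ≤ _ := ContinuousLinearMap.le_opNorm _ _
      _ ≤ _ := by gcongr
  rw [div_lt_iff₀ hc, ← hu] at hn
  exact absurd (pow_le_pow_left₀ (norm_nonneg _) hle 2) (not_le.2 hn)

/-- A plane wave `x ↦ wˣ v` with `|w| = 1` that solves the eigenvalue equation of
`shiftMap Q (-1) + shiftMap R 1` puts the eigenvalue into the spectrum. -/
theorem mem_spectrum_of_plane_wave {E : Type*} [NormedAddCommGroup E] [NormedSpace ℂ E]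
    {Q R : E →L[ℂ] E} {w z : ℂ} {v : E} (hw : ‖w‖ = 1) (hv : v ≠ 0)
    (h : w⁻¹ • Q v + w • R v = z • v) :
    z ∈ spectrum ℂ (shiftMap Q (-1) + shiftMap R 1) := by
  have hw0 : w ≠ 0 := by rintro rfl; simp at hw
  have tel (n : ℕ) :
      (algebraMap ℂ (lp (fun _ : ℤ => E) 2 →L[ℂ] lp (fun _ : ℤ => E) 2) z
          - (shiftMap Q (-1) + shiftMap R 1))
        (∑ m ∈ Finset.range n, lp.single 2 (m : ℤ) (w ^ (m : ℤ) • v))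
      = (w ^ (-1 : ℤ) • lp.single 2 0 (Q v) - w ^ ((n : ℤ) - 1) • lp.single 2 (n : ℤ) (Q v))
        + (w ^ (n : ℤ) • lp.single 2 ((n : ℤ) - 1) (R v) - lp.single 2 (-1) (R v)) := by
    induction n with
    | zero => simp
    | succ n ih =>
      rw [Finset.sum_range_succ, map_add, ih]
      have hz : z • lp.single 2 (n : ℤ) (w ^ (n : ℤ) • v)
          = w ^ ((n : ℤ) - 1) • lp.single (E := fun _ : ℤ => E) 2 (n : ℤ) (Q v)
            + w ^ ((n : ℤ) + 1) • lp.single 2 (n : ℤ) (R v) := by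
        rw [← lp.single_smul, ← lp.single_smul, ← lp.single_smul, ← lp.single_add,
          smul_comm, ← h, smul_add, smul_smul, smul_smul, zpow_sub_one₀ hw0, zpow_add_one₀ hw0]
      rw [_root_.sub_apply, _root_.add_apply,
        shiftMap.apply_single, shiftMap.apply_single, Algebra.algebraMap_eq_smul_one,
        _root_.smul_apply, one_apply_eq_self, hz, map_smul, map_smul,
        lp.single_smul, lp.single_smul]
      push_cast
      rw [sub_neg_eq_add, add_sub_cancel_right]
      abel
  rw [spectrum.mem_iff]
  refine not_isUnit_of_forall_exists_norm_le (M := (‖Q v‖ + ‖Q v‖) + (‖R v‖ + ‖R v‖))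
    (c := ‖v‖ ^ 2) (by positivity) fun n =>
      ⟨∑ m ∈ Finset.range n, lp.single 2 (m : ℤ) (w ^ (m : ℤ) • v), ?_, ?_⟩
  · have := lp.norm_sum_single (p := 2) (E := fun _ : ℤ => E) (by simp)
      (fun m : ℤ => w ^ m • v) ((Finset.range n).map Nat.castEmbedding)
    simpa [norm_smul, hw] using this
  · rw [tel]
    refine (norm_add_le _ _).trans (add_le_add ((norm_sub_le _ _).trans ?_)
      ((norm_sub_le _ _).trans ?_)) <;> simp [norm_smul, hw]

theorem exists_norm_eq_one_mul_add_inv {ρ c : ℝ} (hρ : 0 < ρ) (h : |c| ≤ ρ) :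
    ∃ w : ℂ, ‖w‖ = 1 ∧ (ρ : ℂ) * (w + w⁻¹) = 2 * c := by
  have hb := abs_le.1 h
  refine ⟨Complex.exp (Real.arccos (c / ρ) * I), Complex.norm_exp_ofReal_mul_I _, ?_⟩
  have h2 := Complex.two_cos (Real.arccos (c / ρ) : ℂ)
  rw [neg_mul] at h2
  rw [← Complex.exp_neg, ← h2, ← Complex.ofReal_cos, Real.cos_arccos]
  · have : (ρ : ℂ) ≠ 0 := by exact_mod_cast hρ.ne'
    push_cast
    field_simp
  · rw [le_div_iff₀ hρ]; linarith
  · rw [div_le_iff₀ hρ]; linarith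

/-- Spectrum of the translation-invariant quantum walk: there is a bounded operator
`U₀` on `ℓ²(ℤ, ℂ²)` acting by the free quantum-walk formula; it is unitary and its
spectrum is the arc `{z : |z| = 1, |Re z| ≤ ρ₀}` of the unit circle. -/
theorem free_quantum_walk_spectrum
    (α₀ : ℂ) (h0 : 0 < ‖α₀‖) (h1 : ‖α₀‖ < 1)
    (ρ₀ : ℝ) (hρ₀ : ρ₀ = Real.sqrt (1 - ‖α₀‖ ^ 2)) :
    ∃ U₀ : lp (fun _ : ℤ => EuclideanSpace ℂ (Fin 2)) 2 →L[ℂ]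
            lp (fun _ : ℤ => EuclideanSpace ℂ (Fin 2)) 2,
      (∀ u : lp (fun _ : ℤ => EuclideanSpace ℂ (Fin 2)) 2, ∀ x : ℤ,
        (U₀ u : ∀ _ : ℤ, EuclideanSpace ℂ (Fin 2)) x 0
            = (ρ₀ : ℂ) * (u : ∀ _ : ℤ, EuclideanSpace ℂ (Fin 2)) (x - 1) 0
              + (starRingEnd ℂ) α₀ * (u : ∀ _ : ℤ, EuclideanSpace ℂ (Fin 2)) (x - 1) 1 ∧
          (U₀ u : ∀ _ : ℤ, EuclideanSpace ℂ (Fin 2)) x 1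
            = -α₀ * (u : ∀ _ : ℤ, EuclideanSpace ℂ (Fin 2)) (x + 1) 0
              + (ρ₀ : ℂ) * (u : ∀ _ : ℤ, EuclideanSpace ℂ (Fin 2)) (x + 1) 1) ∧
      U₀ ∈ unitary (lp (fun _ : ℤ => EuclideanSpace ℂ (Fin 2)) 2 →L[ℂ]
            lp (fun _ : ℤ => EuclideanSpace ℂ (Fin 2)) 2) ∧
      spectrum ℂ U₀ = {z : ℂ | ‖z‖ = 1 ∧ |z.re| ≤ ρ₀} := by
  have hpos : 0 < 1 - ‖α₀‖ ^ 2 := by nlinarith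
  have hρ : 0 < ρ₀ := hρ₀ ▸ Real.sqrt_pos.2 hpos
  have hα : α₀ ≠ 0 := norm_pos_iff.1 h0
  have hdet : (ρ₀ : ℂ) * ρ₀ + α₀ * (starRingEnd ℂ) α₀ = 1 := by
    rw [Complex.mul_conj, Complex.normSq_eq_norm_sq, hρ₀, ← Complex.ofReal_mul,
      Real.mul_self_sqrt hpos.le]
    simp
  let L : Matrix (Fin 2) (Fin 2) ℂ ≃⋆ₐ[ℂ]
      (EuclideanSpace ℂ (Fin 2) →L[ℂ] EuclideanSpace ℂ (Fin 2)) := Matrix.toEuclideanCLM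
  let Q : Matrix (Fin 2) (Fin 2) ℂ := !![(ρ₀ : ℂ), (starRingEnd ℂ) α₀; 0, 0]
  let R : Matrix (Fin 2) (Fin 2) ℂ := !![0, 0; -α₀, (ρ₀ : ℂ)]
  have hQ : star Q = !![(ρ₀ : ℂ), 0; α₀, 0] := by
    ext i j; fin_cases i <;> fin_cases j <;> simp [Q, Matrix.star_apply]
  have hR : star R = !![0, -(starRingEnd ℂ) α₀; 0, (ρ₀ : ℂ)] := by
    ext i j; fin_cases i <;> fin_cases j <;> simp [R, Matrix.star_apply]
  have hQR : Q * star R = 0 := by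
    rw [hR]; ext i j; fin_cases i <;> fin_cases j <;> simp [Q, mul_comm]
  have hRQ : R * star Q = 0 := by
    rw [hQ]; ext i j; fin_cases i <;> fin_cases j <;> simp [R, mul_comm]
  have hQR' : star Q * R = 0 := by
    rw [hQ]; ext i j; fin_cases i <;> fin_cases j <;> simp [R]
  have hRQ' : star R * Q = 0 := by
    rw [hR]; ext i j; fin_cases i <;> fin_cases j <;> simp [Q]
  have hleft : star Q * Q + star R * R = 1 := by
    rw [hQ, hR]
    ext i j
    fin_cases i <;> fin_cases j <;> simp [Q, R] <;>
      first | ring1 | linear_combination hdet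
  have hright : Q * star Q + R * star R = 1 := by
    rw [hQ, hR]
    ext i j
    fin_cases i <;> fin_cases j <;> simp [Q, R] <;>
      first | ring1 | linear_combination hdet
  have hQaR : Q + star R = (ρ₀ : ℂ) • 1 := by
    rw [hR]; ext i j; fin_cases i <;> fin_cases j <;> simp [Q]
  have hRaQ : R + star Q = (ρ₀ : ℂ) • 1 := by
    rw [hQ]; ext i j; fin_cases i <;> fin_cases j <;> simp [R]
  set U := shiftMap (L Q) (-1) + shiftMap (L R) 1 with hU
  have hstar : star U = shiftMap (L (star Q)) 1 + shiftMap (L (star R)) (-1) := by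
    rw [hU, star_add, shiftMap.star_eq, shiftMap.star_eq, neg_neg, map_star, map_star]
  have hunit : U ∈ unitary (lp (fun _ : ℤ => EuclideanSpace ℂ (Fin 2)) 2 →L[ℂ]
      lp (fun _ : ℤ => EuclideanSpace ℂ (Fin 2)) 2) := by
    rw [Unitary.mem_iff, hstar, hU]
    constructor
    · simp only [add_mul, mul_add, shiftMap.mul_eq, ← map_mul, hQR', hRQ', map_zero,
        shiftMap.zero_eq, zero_add, add_zero, add_neg_cancel, neg_add_cancel, shiftMap.add_eq,
        ← map_add, hleft, map_one, shiftMap.one_zero]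
    · simp only [add_mul, mul_add, shiftMap.mul_eq, ← map_mul, hQR, hRQ, map_zero,
        shiftMap.zero_eq, zero_add, add_zero, add_neg_cancel, neg_add_cancel, shiftMap.add_eq,
        ← map_add, hright, map_one, shiftMap.one_zero]
  have hnorm : ‖U + star U‖ ≤ 2 * ρ₀ := by
    have hsum : U + star U = shiftMap (L ((ρ₀ : ℂ) • 1)) (-1) + shiftMap (L ((ρ₀ : ℂ) • 1)) 1 := by
      nth_rewrite 1 [← hQaR]
      rw [← hRaQ, map_add, map_add, ← shiftMap.add_eq, ← shiftMap.add_eq, hstar, hU]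
      abel
    have hL : ‖L ((ρ₀ : ℂ) • 1)‖ = ρ₀ := by
      rw [map_smul, map_one, norm_smul, norm_one, mul_one, Complex.norm_of_nonneg hρ.le]
    rw [hsum]
    calc _ ≤ _ := norm_add_le _ _
      _ ≤ ρ₀ + ρ₀ := add_le_add ((shiftMap.norm_le _ _).trans hL.le)
          ((shiftMap.norm_le _ _).trans hL.le)
      _ = 2 * ρ₀ := (two_mul _).symm
  refine ⟨U, fun u x => ⟨?_, ?_⟩, hunit, Set.Subset.antisymm (fun z hz => ?_) ?_⟩
  · simp [hU, L, Q, R, Matrix.ofLp_toEuclideanCLM, Matrix.mulVec, dotProduct,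
      Fin.sum_univ_two, sub_eq_add_neg]
  · simp [hU, L, Q, R, Matrix.ofLp_toEuclideanCLM, Matrix.mulVec, dotProduct,
      Fin.sum_univ_two]
  · have hz1 : ‖z‖ = 1 := by simpa using spectrum.subset_circle_of_unitary hunit hz
    have hmem : ((2 * z.re : ℝ) : ℂ) ∈ spectrum ℂ (U + star U) := fun hu =>
      hz (isUnit_sub_of_isUnit_add_star_sub hunit hz1 hu)
    have hle := ((spectrum.norm_le_norm_mul_of_mem hmem).trans (mul_le_of_le_one_right
      (norm_nonneg _) ContinuousLinearMap.norm_id_le)).trans hnorm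
    rw [Complex.norm_real, Real.norm_eq_abs, abs_mul, abs_two] at hle
    exact ⟨hz1, by linarith⟩
  · rintro z ⟨hz1, hz2⟩
    obtain ⟨w, hw, hwz⟩ := exists_norm_eq_one_mul_add_inv hρ hz2
    have hw0 : w ≠ 0 := by rintro rfl; simp at hw
    have hzz : z * (starRingEnd ℂ) z = 1 := by
      rw [Complex.mul_conj, Complex.normSq_eq_norm_sq, hz1]; simp
    have hquad : z * z + 1 = z * ((ρ₀ : ℂ) * (w + w⁻¹)) := by
      have := Complex.add_conj z
      push_cast at this
      rw [hwz, ← this]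
      linear_combination -hzz
    have hww : w * w⁻¹ = 1 := mul_inv_cancel₀ hw0
    refine mem_spectrum_of_plane_wave
      (v := WithLp.toLp 2 ![(starRingEnd ℂ) α₀ * w⁻¹, z - ρ₀ * w⁻¹]) hw (fun hv => ?_) ?_
    · have := congrArg (fun v : EuclideanSpace ℂ (Fin 2) => v 0) hv
      simp [hα, hw0] at this
    · ext i
      fin_cases i
      · simp [L, Q, R]
        ring
      · simp [L, Q, R]
        linear_combination (-1 : ℂ) * hquad - hdet * (w * w⁻¹) - hww
end
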